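/- arXiv:1007.2492 — 2 statements merged into one kernel-verified Lean document; each statement's English description precedes it below -/
import Mathlib

section
/- Let P* be the group defined by the presentation with three generators a, b, c and the six relations a² = 1, b³ = 1, (a·b·a·b⁻¹·a·b⁻¹)² = 1, c² = 1, (c·a)² = 1, (c·b)² = 1. Then P* has exactly 13 conjugacy classes. -/
/-- The six relations a², b³, (abab⁻¹ab⁻¹)², c², (ca)², (cb)² on the free group over
three generators a, b, c. -/
def octRelsStar : Set (FreeGroup (Fin 3)) :=
  { (FreeGroup.of 0) ^ 2,
    (FreeGroup.of 1) ^ 3,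
    (FreeGroup.of 0 * FreeGroup.of 1 * FreeGroup.of 0 * (FreeGroup.of 1)⁻¹ *
      FreeGroup.of 0 * (FreeGroup.of 1)⁻¹) ^ 2,
    (FreeGroup.of 2) ^ 2,
    (FreeGroup.of 2 * FreeGroup.of 0) ^ 2,
    (FreeGroup.of 2 * FreeGroup.of 1) ^ 2 }

set_option linter.unusedSimpArgs false

namespace Oct

abbrev G := PresentedGroup octRelsStar

def ga : G := PresentedGroup.of 0
def gb : G := PresentedGroup.of 1
def gc : G := PresentedGroup.of 2

theorem rel_one (r : FreeGroup (Fin 3)) (h : r ∈ octRelsStar) :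
    PresentedGroup.mk octRelsStar r = 1 := PresentedGroup.one_of_mem h

theorem haa : ga * ga = 1 := by
  have := rel_one ((FreeGroup.of 0) ^ 2) (by simp [octRelsStar])
  rw [map_pow, pow_two] at this; exact this
theorem hbbb : gb * gb * gb = 1 := by
  have := rel_one ((FreeGroup.of 1) ^ 3) (by simp [octRelsStar])
  rw [map_pow, pow_succ, pow_two] at this; exact this
theorem hcc : gc * gc = 1 := by
  have := rel_one ((FreeGroup.of 2) ^ 2) (by simp [octRelsStar])
  rw [map_pow, pow_two] at this; exact this
theorem hR : (ga * gb * ga * gb⁻¹ * ga * gb⁻¹) * (ga * gb * ga * gb⁻¹ * ga * gb⁻¹) = 1 := by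
  have := rel_one ((FreeGroup.of 0 * FreeGroup.of 1 * FreeGroup.of 0 * (FreeGroup.of 1)⁻¹ *
      FreeGroup.of 0 * (FreeGroup.of 1)⁻¹) ^ 2) (by simp [octRelsStar])
  rw [map_pow, pow_two] at this
  simp only [map_mul, map_inv] at this; exact this
theorem hca : gc * ga * (gc * ga) = 1 := by
  have := rel_one ((FreeGroup.of 2 * FreeGroup.of 0) ^ 2) (by simp [octRelsStar])
  rw [map_pow, pow_two, map_mul] at this; exact this
theorem hcb : gc * gb * (gc * gb) = 1 := by
  have := rel_one ((FreeGroup.of 2 * FreeGroup.of 1) ^ 2) (by simp [octRelsStar])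
  rw [map_pow, pow_two, map_mul] at this; exact this

theorem ai : ga⁻¹ = ga := inv_eq_of_mul_eq_one_left haa
theorem ci : gc⁻¹ = gc := inv_eq_of_mul_eq_one_left hcc
theorem ca : gc * ga = ga * gc := by
  have h := eq_inv_of_mul_eq_one_left hca
  rw [mul_inv_rev, ai, ci] at h; exact h
theorem cb : gc * gb = gb⁻¹ * gc := by
  have h := eq_inv_of_mul_eq_one_left hcb
  rw [mul_inv_rev, ci] at h; exact h
theorem bb : gb * gb = gb⁻¹ := eq_inv_of_mul_eq_one_left hbbb
theorem cB : gc * gb⁻¹ = gb * gc := by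
  have h := congrArg (fun x => gb * x * gb⁻¹) cb
  simp only [mul_assoc, mul_inv_cancel_left, mul_inv_cancel, mul_one] at h
  exact h.symm

def lt : Fin 3 → G := ![ga, gb, gb⁻¹]

def ev (w : List (Fin 3)) : G := (w.map lt).prod

theorem ev_nil : ev [] = 1 := rfl
theorem ev_cons (x w) : ev (x :: w) = lt x * ev w := by simp [ev]
theorem ev_append (u v) : ev (u ++ v) = ev u * ev v := by simp [ev]

def li : Fin 3 → Fin 3 := ![0, 2, 1]
theorem lt_li (x) : lt (li x) = (lt x)⁻¹ := by
  fin_cases x <;> simp [lt, li, ai]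

def wi : List (Fin 3) → List (Fin 3)
  | [] => []
  | x :: t => wi t ++ [li x]

theorem ev_wi (w) : ev (wi w) = (ev w)⁻¹ := by
  induction w with
  | nil => simp [wi, ev]
  | cons x t ih => simp [wi, ev_append, ev_cons, ev_nil, ih, lt_li]

theorem cyc (u v : List (Fin 3)) (h : ev (u ++ v) = 1) : ev (v ++ u) = 1 := by
  rw [ev_append] at *; exact mul_eq_one_comm.mp h

theorem split (u v : List (Fin 3)) (h : ev (u ++ v) = 1) : ev u = ev (wi v) := by
  rw [ev_append] at h; rw [ev_wi]; exact eq_inv_of_mul_eq_one_left h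

def stripP : List (Fin 3) → List (Fin 3) → Option (List (Fin 3))
  | [], w => some w
  | _ :: _, [] => none
  | x :: t, y :: w => if x = y then stripP t w else none

theorem stripP_spec (p w r) (h : stripP p w = some r) : w = p ++ r := by
  induction p generalizing w with
  | nil => simp [stripP] at h; simp [h]
  | cons x t ih =>
    cases w with
    | nil => simp [stripP] at h
    | cons y w =>
      simp only [stripP] at h
      split_ifs at h with hxy
      rw [ih w h, hxy]; rfl

def rw1 (R : List (List (Fin 3) × List (Fin 3))) : List (Fin 3) → List (Fin 3)
  | [] => []
  | x :: t =>
    match R.findSome? (fun r => (stripP r.1 (x :: t)).map (r.2 ++ ·)) with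
    | some y => y
    | none => x :: rw1 R t

theorem rw1_spec (R) (hR : ∀ r ∈ R, ev r.1 = ev r.2) (w) : ev (rw1 R w) = ev w := by
  induction w with
  | nil => rfl
  | cons x t ih =>
    simp only [rw1]
    split
    · next y hy =>
      obtain ⟨r, hr, h⟩ := List.exists_of_findSome?_eq_some hy
      simp only [Option.map_eq_some_iff] at h
      obtain ⟨z, hz, rfl⟩ := h
      rw [stripP_spec _ _ _ hz, ev_append, ev_append, hR r hr]
    · rw [ev_cons, ih, ev_cons]

def rwn (R : List (List (Fin 3) × List (Fin 3))) : ℕ → List (Fin 3) → List (Fin 3)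
  | 0, w => w
  | n + 1, w => rwn R n (rw1 R w)

theorem rwn_spec (R) (hR : ∀ r ∈ R, ev r.1 = ev r.2) (n w) : ev (rwn R n w) = ev w := by
  induction n generalizing w with
  | zero => rfl
  | succ n ih => rw [rwn, ih, rw1_spec R hR]

def rules : List (List (Fin 3) × List (Fin 3)) :=
  [([0,0], []),
   ([1,2], []),
   ([2,1], []),
   ([1,1], [2]),
   ([2,2], [1]),
   ([2,0,1,0,1,0], [0,2,0,2,0,1]),
   ([2,0,2,0,2,0,1], [1,0,1,0,1,0]),
   ([1,0,1,0,1,0,2], [2,0,2,0,2,0]),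
   ([1,0,1,0,1,0,1], [2,0,2,0,2,0,2]),
   ([1,0,2,0,2,0], [0,1,0,1,0,2]),
   ([2,0,2,0,1,0], [0,2,0,1,0,1]),
   ([1,0,2,0,1,0], [0,2,0,1,0,2]),
   ([2,0,1,0,2,0], [0,1,0,2,0,1]),
   ([1,0,1,0,2,0], [0,1,0,2,0,2]),
   ([2,0,2,0,2,0,2,0], [0,2,0,2,0,2,0,2])]

theorem base : ev [0,1,0,2,0,2,0,1,0,2,0,2] = 1 := by
  have := hR
  simpa [ev, lt, mul_assoc] using this
theorem base' : ev [1,0,1,0,2,0,1,0,1,0,2,0] = 1 := by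
  have h := ev_wi [0,1,0,2,0,2,0,1,0,2,0,2]
  rw [base, inv_one] at h; exact h

theorem r0 : ev [0,0] = ev [] := by
  simp [ev, lt, haa, bb, ← mul_inv_rev]
theorem r1 : ev [1,2] = ev [] := by
  simp [ev, lt, haa, bb, ← mul_inv_rev]
theorem r2 : ev [2,1] = ev [] := by
  simp [ev, lt, haa, bb, ← mul_inv_rev]
theorem r3 : ev [1,1] = ev [2] := by
  simp [ev, lt, haa, bb, ← mul_inv_rev]
theorem r4 : ev [2,2] = ev [1] := by
  simp [ev, lt, haa, bb, ← mul_inv_rev]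
theorem r5 : ev [2,0,1,0,1,0] = ev [0,2,0,2,0,1] := split [2,0,1,0,1,0] [2,0,1,0,1,0] (cyc [1,0,1,0] [2,0,1,0,1,0,2,0] base')
theorem r9 : ev [1,0,2,0,2,0] = ev [0,1,0,1,0,2] := split [1,0,2,0,2,0] [1,0,2,0,2,0] (cyc [0] [1,0,2,0,2,0,1,0,2,0,2] base)
theorem r10 : ev [2,0,2,0,1,0] = ev [0,2,0,1,0,1] := split [2,0,2,0,1,0] [2,0,2,0,1,0] (cyc [0,1,0] [2,0,2,0,1,0,2,0,2] base)
theorem r11 : ev [1,0,2,0,1,0] = ev [0,2,0,1,0,2] := split [1,0,2,0,1,0] [1,0,2,0,1,0] (cyc [1,0] [1,0,2,0,1,0,1,0,2,0] base')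
theorem r12 : ev [2,0,1,0,2,0] = ev [0,1,0,2,0,1] := split [2,0,1,0,2,0] [2,0,1,0,2,0] (cyc [0,1,0,2,0] [2,0,1,0,2,0,2] base)
theorem r13 : ev [1,0,1,0,2,0] = ev [0,1,0,2,0,2] := split [1,0,1,0,2,0] [1,0,1,0,2,0] (cyc [] [1,0,1,0,2,0,1,0,1,0,2,0] base')
theorem cg (p s : List (Fin 3)) {l r : List (Fin 3)} (h : ev l = ev r)
    (u v : List (Fin 3)) (hu : p ++ l ++ s = u) (hv : p ++ r ++ s = v) : ev u = ev v := by
  subst hu; subst hv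
  simp only [ev_append, h]
theorem r6 : ev [2,0,2,0,2,0,1] = ev [1,0,1,0,1,0] := (((cg [2] [] r5 [2,2,0,1,0,1,0] [2,0,2,0,2,0,1] rfl rfl).symm).trans (cg [] [0,1,0,1,0] r4 [2,2,0,1,0,1,0] [1,0,1,0,1,0] rfl rfl))
theorem r7 : ev [1,0,1,0,1,0,2] = ev [2,0,2,0,2,0] := (((cg [] [2] r6 [2,0,2,0,2,0,1,2] [1,0,1,0,1,0,2] rfl rfl).symm).trans (cg [2,0,2,0,2,0] [] r1 [2,0,2,0,2,0,1,2] [2,0,2,0,2,0] rfl rfl))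
theorem r8 : ev [1,0,1,0,1,0,1] = ev [2,0,2,0,2,0,2] := (((cg [] [1] r6 [2,0,2,0,2,0,1,1] [1,0,1,0,1,0,1] rfl rfl).symm).trans (cg [2,0,2,0,2,0] [] r3 [2,0,2,0,2,0,1,1] [2,0,2,0,2,0,2] rfl rfl))
theorem r14 : ev [2,0,2,0,2,0,2,0] = ev [0,2,0,2,0,2,0,2] := ((((cg [2,0] [] r7 [2,0,1,0,1,0,1,0,2] [2,0,2,0,2,0,2,0] rfl rfl).symm).trans (cg [] [1,0,2] r5 [2,0,1,0,1,0,1,0,2] [0,2,0,2,0,1,1,0,2] rfl rfl)).trans (cg [0,2,0,2,0] [0,2] r3 [0,2,0,2,0,1,1,0,2] [0,2,0,2,0,2,0,2] rfl rfl))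

theorem rules_ok : ∀ r ∈ rules, ev r.1 = ev r.2 := by
  simp only [rules, List.forall_mem_cons]
  refine ⟨r0, r1, r2, r3, r4, r5, r6, r7, r8, r9, r10, r11, r12, r13, r14, by simp⟩

def nf : List (List (Fin 3)) :=
  [[], [0], [1], [2], [0,1], [0,2],
   [1,0], [2,0], [0,1,0], [0,2,0], [1,0,1], [1,0,2],
   [2,0,1], [2,0,2], [0,1,0,1], [0,1,0,2], [0,2,0,1], [0,2,0,2],
   [1,0,1,0], [1,0,2,0], [2,0,1,0], [2,0,2,0], [0,1,0,1,0], [0,1,0,2,0],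
   [0,2,0,1,0], [0,2,0,2,0], [1,0,1,0,1], [1,0,1,0,2], [1,0,2,0,1], [1,0,2,0,2],
   [2,0,1,0,1], [2,0,1,0,2], [2,0,2,0,1], [2,0,2,0,2], [0,1,0,1,0,1], [0,1,0,1,0,2],
   [0,1,0,2,0,1], [0,1,0,2,0,2], [0,2,0,1,0,1], [0,2,0,1,0,2], [0,2,0,2,0,1], [0,2,0,2,0,2],
   [1,0,1,0,1,0], [2,0,2,0,2,0], [0,1,0,1,0,1,0], [0,2,0,2,0,2,0], [2,0,2,0,2,0,2], [0,2,0,2,0,2,0,2]]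

theorem nf_closed : ∀ w ∈ nf, ∀ x : Fin 3, rwn rules 12 (w ++ [x]) ∈ nf := by
  decide +kernel

def cp (e : Bool) : G := if e then gc else 1

def el (p : List (Fin 3) × Bool) : G := ev p.1 * cp p.2

def els : List (List (Fin 3) × Bool) := nf ×ˢ [false, true]

theorem mem_els (w e) (h : w ∈ nf) : (w, e) ∈ els := by
  simp [els, h]

def flip (e : Bool) (x : Fin 3) : Fin 3 := if e then ![0, 2, 1] x else x

theorem cp_lt (e x) : cp e * lt x = lt (flip e x) * cp e := by
  cases e
  · simp [cp, flip]
  · fin_cases x <;> simp [cp, flip, lt, ca, cb, cB]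

theorem step_lt (g : G) (x : Fin 3) (h : ∃ p ∈ els, el p = g) : ∃ p ∈ els, el p = g * lt x := by
  obtain ⟨⟨w, e⟩, hp, rfl⟩ := h
  have hw : w ∈ nf := by
    simp [els] at hp; exact hp
  refine ⟨(rwn rules 12 (w ++ [flip e x]), e), mem_els _ _ (nf_closed w hw _), ?_⟩
  simp only [el]
  rw [rwn_spec _ rules_ok, ev_append, mul_assoc, mul_assoc, cp_lt, ev_cons, ev_nil, mul_one]

theorem step_c (g : G) (h : ∃ p ∈ els, el p = g) : ∃ p ∈ els, el p = g * gc := by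
  obtain ⟨⟨w, e⟩, hp, rfl⟩ := h
  have hw : w ∈ nf := by
    simp [els] at hp; exact hp
  refine ⟨(w, !e), mem_els _ _ hw, ?_⟩
  cases e <;> simp [el, cp, mul_assoc, hcc]

theorem surj (g : G) : ∃ p ∈ els, el p = g := by
  have hg : g ∈ Subgroup.closure (Set.range (PresentedGroup.of (rels := octRelsStar))) := by
    rw [PresentedGroup.closure_range_of]; trivial
  induction hg using Subgroup.closure_induction_right with
  | one => exact ⟨([], false), by decide, by simp [el, ev, cp]⟩
  | mul_right x hx y hy ih =>
    obtain ⟨i, rfl⟩ := hy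
    fin_cases i
    · exact step_lt x 0 ih
    · exact step_lt x 1 ih
    · exact step_c x ih
  | mul_inv_cancel x hx y hy ih =>
    obtain ⟨i, rfl⟩ := hy
    fin_cases i
    · have := step_lt x 0 ih
      rw [show lt 0 = ga⁻¹ from ai.symm] at this; exact this
    · exact step_lt x 2 ih
    · have := step_c x ih
      rw [← ci] at this; exact this

def fa : Fin 16 → Fin 16 := ![2, 3, 0, 1, 8, 5, 6, 9, 4, 7, 10, 14, 15, 13, 11, 12]
def fb : Fin 16 → Fin 16 := ![0, 1, 4, 5, 6, 7, 2, 3, 10, 11, 12, 13, 8, 9, 14, 15]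
def fc : Fin 16 → Fin 16 := ![1, 0, 3, 2, 7, 6, 5, 4, 9, 8, 13, 12, 11, 10, 15, 14]

def pa : Equiv.Perm (Fin 16) := ⟨fa, fa, by intro x; revert x; decide, by intro x; revert x; decide⟩
def pb : Equiv.Perm (Fin 16) :=
  ⟨fb, fun x => fb (fb x), by intro x; revert x; decide, by intro x; revert x; decide⟩
def pc : Equiv.Perm (Fin 16) := ⟨fc, fc, by intro x; revert x; decide, by intro x; revert x; decide⟩

def pg : Fin 3 → Equiv.Perm (Fin 16) := ![pa, pb, pc]

theorem pg_rel : ∀ r ∈ octRelsStar, FreeGroup.lift pg r = 1 := by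
  intro r hr
  simp only [octRelsStar, Set.mem_insert_iff, Set.mem_singleton_iff] at hr
  rcases hr with rfl | rfl | rfl | rfl | rfl | rfl <;>
    simp only [map_pow, map_mul, map_inv, FreeGroup.lift_apply_of] <;> decide +kernel

def phi : G →* Equiv.Perm (Fin 16) := PresentedGroup.toGroup pg_rel

def tb : Fin 3 → ℕ
  | 0 => 14690718295965306930
  | 1 => 18345655774362358800
  | 2 => 18355151303374698000
def aw : List (Fin 3) → ℕ → ℕ
  | [], x => x
  | y :: t, x => (tb y >>> (4 * aw t x)) % 16
def act (p : List (Fin 3) × Bool) (x : ℕ) : ℕ :=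
  aw p.1 (bif p.2 then (17270123185540899585 >>> (4 * x)) % 16 else x)

theorem phi_a : phi ga = pa := PresentedGroup.toGroup.of pg_rel
theorem phi_b : phi gb = pb := PresentedGroup.toGroup.of pg_rel
theorem phi_c : phi gc = pc := PresentedGroup.toGroup.of pg_rel

theorem tb_a : ∀ x : Fin 16, (fa x : ℕ) = (tb 0 >>> (4 * (x : ℕ))) % 16 := by decide +kernel
theorem tb_b : ∀ x : Fin 16, (fb x : ℕ) = (tb 1 >>> (4 * (x : ℕ))) % 16 := by decide +kernel
theorem tb_B : ∀ x : Fin 16, (fb (fb x) : ℕ) = (tb 2 >>> (4 * (x : ℕ))) % 16 := by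
  decide +kernel
theorem tb_c : ∀ x : Fin 16, (fc x : ℕ) = (17270123185540899585 >>> (4 * (x : ℕ))) % 16 := by
  decide +kernel

theorem phi_lt (y) (x : Fin 16) : (phi (lt y) x : ℕ) = (tb y >>> (4 * (x : ℕ))) % 16 := by
  fin_cases y
  · exact (congrArg (fun q : Equiv.Perm (Fin 16) => (q x : ℕ)) phi_a).trans (tb_a x)
  · exact (congrArg (fun q : Equiv.Perm (Fin 16) => (q x : ℕ)) phi_b).trans (tb_b x)
  · have h : phi (lt 2) = pb⁻¹ := by rw [← phi_b, ← map_inv]; rfl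
    exact (congrArg (fun q : Equiv.Perm (Fin 16) => (q x : ℕ)) h).trans (tb_B x)

theorem phi_ev (w) (x : Fin 16) : (phi (ev w) x : ℕ) = aw w x := by
  induction w with
  | nil => simp [ev_nil, aw]
  | cons y t ih => rw [ev_cons, map_mul, Equiv.Perm.mul_apply, phi_lt, ih, aw]

theorem phi_el (p) (x : Fin 16) : (phi (el p) x : ℕ) = act p x := by
  obtain ⟨w, e⟩ := p
  rw [el, map_mul, Equiv.Perm.mul_apply, phi_ev, act]
  cases e
  · simp [cp]
  · have h : (pc x : ℕ) = _ := tb_c x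
    simp only [cp, phi_c, if_true, h, cond_true]

def bs : List (Fin 16) := [0, 2]

def dtab : ℕ :=
  707302700215430771766353752089167834446960899104556573514167372041271481648697389827329683129599192928649170271096666338130029786518501615226479548615611456209709797147122501094061711292705322288233265262834010340647935884386949704702878129220341002178966014097581415337288352041010468098656985422964533361373702874210177115655185827493469812952549474549282693542100066635593735244915217772010914092361033645142780108055674002645488476798958629262934198796678010429808482653395659151848598475704194473960275941545592179502714922048532802703367029651690380025736852066705393204027531418869993872718010651770880

def dec (u v : ℕ) : ℕ := (dtab >>> (8 * (16 * u + v))) % 256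

theorem dec_ok : ∀ i : Fin els.length, dec (act els[i] 0) (act els[i] 2) = i := by
  decide +kernel

theorem act_inj (p) (hp : p ∈ els) (q) (hq : q ∈ els)
    (h : ∀ x ∈ bs, act p (x : ℕ) = act q (x : ℕ)) : p = q := by
  obtain ⟨i, hi, rfl⟩ := List.mem_iff_getElem.mp hp
  obtain ⟨j, hj, rfl⟩ := List.mem_iff_getElem.mp hq
  have h1 := dec_ok ⟨i, hi⟩
  have h2 := dec_ok ⟨j, hj⟩
  have e0 := h 0 (by simp [bs])
  have e2 := h 2 (by simp [bs])
  simp only [Fin.getElem_fin] at h1 h2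
  have : i = j := by
    rw [← h1, ← h2]; exact congrArg₂ dec e0 e2
  subst this; rfl

theorem phi_inj (g h : G) (hgh : ∀ x ∈ bs, phi g x = phi h x) : g = h := by
  obtain ⟨p, hp, rfl⟩ := surj g
  obtain ⟨q, hq, rfl⟩ := surj h
  rw [act_inj p hp q hq]
  intro x hx
  rw [← phi_el, ← phi_el, hgh x hx]

def reps : List (List (Fin 3) × Bool) :=
  [([], false), ([], true), ([0], false), ([0], true), ([1], false), ([0,1], false), ([0,1], true), ([0,1,0,1], false), ([0,1,0,1], true), ([0,1,0,2], false), ([0,1,0,1,0,1], true), ([0,1,0,2,0,1], true), ([0,2,0,2,0,2,0,2], false)]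

def rep (k : Fin 13) : List (Fin 3) × Bool := reps.getD k ([], false)

def cert : List (Fin 13 × ℕ) :=
  [(0, 0), (1, 0), (2, 0), (3, 0), (4, 0), (1, 6), (4, 1), (1, 4), (5, 0), (6, 0), (5, 1), (6, 1),
   (5, 2), (6, 2), (5, 3), (6, 3), (4, 2), (1, 10), (4, 3), (1, 8), (5, 5), (3, 4), (2, 4), (6, 4),
   (2, 6), (6, 7), (5, 6), (3, 6), (7, 0), (8, 0), (9, 0), (8, 9), (9, 1), (8, 10), (7, 1), (8, 1),
   (7, 2), (8, 2), (9, 2), (8, 5), (9, 3), (8, 6), (7, 3), (8, 3), (5, 9), (3, 8), (2, 8), (6, 8),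
   (2, 10), (6, 11), (5, 10), (3, 10), (9, 4), (1, 22), (4, 12), (8, 4), (7, 5), (1, 20), (4, 13), (8, 8),
   (4, 14), (8, 11), (7, 6), (1, 26), (4, 15), (8, 7), (9, 7), (1, 24), (5, 22), (10, 0), (2, 32), (10, 5),
   (2, 20), (11, 0), (2, 24), (10, 9), (2, 22), (10, 10), (2, 26), (11, 1), (2, 30), (10, 6), (5, 25), (10, 1),
   (5, 26), (10, 2), (5, 21), (10, 3), (9, 8), (1, 30), (9, 11), (1, 32), (2, 56), (3, 20), (12, 0), (1, 56)]

theorem cert_ok : ∀ i : Fin els.length,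
    els.getD (cert.getD i (0, 0)).2 ([], false) ∈ els ∧
    ∀ x ∈ bs, act (els.getD (cert.getD i (0, 0)).2 ([], false))
      (act (rep (cert.getD i (0, 0)).1) (x : ℕ)) =
      act els[i] (act (els.getD (cert.getD i (0, 0)).2 ([], false)) (x : ℕ)) := by
  decide +kernel

theorem conj_surj : ∀ p ∈ els, ∃ k : Fin 13, ∃ m ∈ els,
    ∀ x ∈ bs, act m (act (rep k) (x : ℕ)) = act p (act m (x : ℕ)) := by
  intro p hp
  obtain ⟨i, hi, rfl⟩ := List.mem_iff_getElem.mp hp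
  obtain ⟨h1, h2⟩ := cert_ok ⟨i, hi⟩
  exact ⟨_, _, h1, h2⟩

def col (u v : ℕ) : Fin 13 := (cert.getD (dec u v) (0, 0)).1

def colG (g : G) : Fin 13 := col (phi g 0 : ℕ) (phi g 2 : ℕ)

theorem colG_el (p) : colG (el p) = col (act p 0) (act p 2) := by
  rw [colG, phi_el, phi_el]; rfl

theorem col_inv : ∀ s ∈ ([(([0], false), ([0], false)), (([1], false), ([2], false)),
      (([], true), ([], true))] : List ((List (Fin 3) × Bool) × (List (Fin 3) × Bool))),
    ∀ p ∈ els, col (act s.1 (act p (act s.2 0))) (act s.1 (act p (act s.2 2))) =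
      col (act p 0) (act p 2) := by
  decide +kernel

theorem col_rep : ∀ k : Fin 13, col (act (rep k) 0) (act (rep k) 2) = k := by
  decide +kernel

theorem colG_step (s t : List (Fin 3) × Bool) (hst : el t = (el s)⁻¹)
    (h : (s, t) ∈ ([(([0], false), ([0], false)), (([1], false), ([2], false)),
      (([], true), ([], true))] : List ((List (Fin 3) × Bool) × (List (Fin 3) × Bool))))
    (g : G) : colG (el s * g * (el s)⁻¹) = colG g := by
  obtain ⟨p, hp, rfl⟩ := surj g
  rw [colG_el, ← col_inv _ h p hp, ← hst, colG]
  simp only [map_mul, Equiv.Perm.mul_apply, phi_el]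
  rfl

def stab : Subgroup G where
  carrier := {h | ∀ g, colG (h * g * h⁻¹) = colG g}
  one_mem' := by intro g; simp
  mul_mem' := by
    intro x y hx hy g
    have h1 := hx (y * g * y⁻¹)
    rw [hy g] at h1
    rw [← h1]; simp [mul_assoc]
  inv_mem' := by
    intro x hx g
    have h1 := hx (x⁻¹ * g * x⁻¹⁻¹)
    rw [← h1]; simp [mul_assoc]

theorem colG_conj (h g : G) : colG (h * g * h⁻¹) = colG g := by
  have hs : stab = ⊤ := by
    rw [eq_top_iff, ← PresentedGroup.closure_range_of, Subgroup.closure_le]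
    rintro _ ⟨i, rfl⟩
    have ea : el ([0], false) = ga := by simp [el, ev, lt, cp]
    have eb : el ([1], false) = gb := by simp [el, ev, lt, cp]
    have eB : el ([2], false) = gb⁻¹ := by simp [el, ev, lt, cp]
    have ec : el ([], true) = gc := by simp [el, ev, cp]
    fin_cases i
    · intro g
      have := colG_step ([0], false) ([0], false) (by rw [ea, ai]) (by simp) g
      rw [ea] at this; exact this
    · intro g
      have := colG_step ([1], false) ([2], false) (by rw [eb, eB]) (by simp) g
      rw [eb] at this; exact this
    · intro g
      have := colG_step ([], true) ([], true) (by rw [ec, ci]) (by simp) g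
      rw [ec] at this; exact this
  have : h ∈ stab := by rw [hs]; trivial
  exact this g

def F (k : Fin 13) : ConjClasses G := ConjClasses.mk (el (rep k))

theorem F_bij : Function.Bijective F := by
  constructor
  · intro k l h
    rw [F, F, ConjClasses.mk_eq_mk_iff_isConj, isConj_iff] at h
    obtain ⟨c, hc⟩ := h
    have h1 := colG_conj c (el (rep k))
    rw [hc, colG_el, colG_el, col_rep, col_rep] at h1
    exact h1.symm
  · intro C
    obtain ⟨g, rfl⟩ := ConjClasses.mk_surjective C
    obtain ⟨p, hp, rfl⟩ := surj g
    obtain ⟨k, m, hm, h⟩ := conj_surj p hp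
    refine ⟨k, ?_⟩
    rw [F, ConjClasses.mk_eq_mk_iff_isConj, isConj_iff]
    refine ⟨el m, ?_⟩
    rw [mul_inv_eq_iff_eq_mul]
    apply phi_inj
    intro x hx
    apply Fin.ext
    simp [phi_el, h x hx]

end Oct

/-- the group presented by
⟨a, b, c ∣ a² = b³ = (abab⁻¹ab⁻¹)² = c² = (ca)² = (cb)² = 1⟩ has exactly 13 conjugacy classes. -/
theorem stmt_9 : Nat.card (ConjClasses (PresentedGroup octRelsStar)) = 13 := by
  rw [← Nat.card_eq_of_bijective Oct.F Oct.F_bij, Nat.card_fin]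
end

section
/- Let P* be the group defined by the presentation with three generators a, b, c and the six relations a² = 1, b³ = 1, (a·b·a·b⁻¹·a·b⁻¹)² = 1, c² = 1, (c·a)² = 1, (c·b)² = 1 (a finite group of order 96). Then the character of every finite-dimensional irreducible complex representation of P* takes only real values. -/
namespace OctStar

/-- words in the letters 0 = a, 1 = b, 2 = b⁻¹, 3 = c -/
abbrev Wd := List ℕ

def pre : Wd → Wd → Option Wd
  | [], w => some w
  | _ :: _, [] => none
  | x :: l, y :: w => bif Nat.beq x y then pre l w else none

def hd : List (Wd × Wd) → Wd → Option Wd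
  | [], _ => none
  | p :: R, w => match pre p.1 w with
    | some v => some (p.2 ++ v)
    | none => hd R w

def stepO (R : List (Wd × Wd)) : Wd → Option Wd
  | [] => none
  | x :: w => match hd R (x :: w) with
    | some v => some v
    | none => match stepO R w with
      | some v => some (x :: v)
      | none => none

def step (R : List (Wd × Wd)) (w : Wd) : Wd := (stepO R w).getD w

def nrm (R : List (Wd × Wd)) : ℕ → Wd → Wd
  | 0, w => w
  | n + 1, w => match stepO R w with
    | some v => nrm R n v
    | none => w

/-- Knuth-Bendix completion along a list of critical pairs. -/
def run : List (Wd × Wd) → List (ℕ × ℕ × Wd × Bool) → List (Wd × Wd)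
  | R, [] => R
  | R, (i, j, o, s) :: cs =>
    let u := nrm R 20 (step [R.getD i ([], [])] o)
    let v := nrm R 20 (step [R.getD j ([], [])] o)
    run (R ++ [if s then (v, u) else (u, v)]) cs

def sw : ℕ → ℕ
  | 1 => 2
  | 2 => 1
  | n => n

def winv (w : Wd) : Wd := (w.map sw).reverse

def R0 : List (Wd × Wd) :=
  [([0, 0], []), ([1, 1], [2]), ([1, 2], []), ([2, 1], []), ([3, 3], []), ([2, 2], [1]),
   ([3, 0], [0, 3]), ([3, 1], [2, 3]), ([3, 2], [1, 3]),
   ([0, 1, 0, 2, 0, 2, 0, 1, 0, 2, 0, 2], [])]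

def cert : List (ℕ × ℕ × Wd × Bool) :=
  [(0, 9, [0, 0, 1, 0, 2, 0, 2, 0, 1, 0, 2, 0, 2], false),
   (1, 10, [1, 1, 0, 2, 0, 2, 0, 1, 0, 2, 0, 2], false),
   (2, 11, [1, 2, 0, 2, 0, 2, 0, 1, 0, 2, 0, 2], false),
   (0, 12, [0, 0, 2, 0, 2, 0, 1, 0, 2, 0, 2], false),
   (2, 13, [1, 2, 0, 2, 0, 1, 0, 2, 0, 2], false),
   (0, 14, [0, 0, 2, 0, 1, 0, 2, 0, 2], false),
   (2, 15, [1, 2, 0, 1, 0, 2, 0, 2], true),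
   (1, 16, [1, 1, 0, 1, 0, 2, 0], false),
   (7, 16, [3, 1, 0, 1, 0, 2, 0], false),
   (8, 17, [3, 2, 0, 1, 0, 2, 0], false),
   (16, 0, [1, 0, 1, 0, 2, 0, 0], false),
   (17, 0, [2, 0, 1, 0, 2, 0, 0], false),
   (0, 20, [0, 0, 1, 0, 2, 0, 2, 0], false),
   (1, 22, [1, 1, 0, 2, 0, 2, 0], true),
   (3, 22, [2, 1, 0, 2, 0, 2, 0], true),
   (7, 22, [3, 1, 0, 2, 0, 2, 0], false),
   (0, 21, [0, 0, 1, 0, 2, 0, 1, 0], false),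
   (1, 26, [1, 1, 0, 2, 0, 1, 0], false),
   (27, 0, [2, 0, 2, 0, 1, 0, 0], false),
   (0, 28, [0, 0, 2, 0, 1, 0, 1, 0], false),
   (5, 29, [2, 2, 0, 1, 0, 1, 0], true),
   (23, 5, [1, 0, 1, 0, 1, 0, 2, 2], false),
   (22, 30, [1, 0, 2, 0, 2, 0, 2, 0, 1], true)]

def F : List (Wd × Wd) :=
  [([0, 0], []),
   ([1, 1], [2]),
   ([1, 2], []),
   ([2, 1], []),
   ([3, 3], []),
   ([2, 2], [1]),
   ([3, 0], [0, 3]),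
   ([3, 1], [2, 3]),
   ([3, 2], [1, 3]),
   ([1, 0, 1, 0, 2, 0], [0, 1, 0, 2, 0, 2]),
   ([2, 0, 1, 0, 2, 0], [0, 1, 0, 2, 0, 1]),
   ([1, 0, 2, 0, 2, 0], [0, 1, 0, 1, 0, 2]),
   ([1, 0, 1, 0, 1, 0, 2], [2, 0, 2, 0, 2, 0]),
   ([1, 0, 2, 0, 1, 0], [0, 2, 0, 1, 0, 2]),
   ([2, 0, 2, 0, 1, 0], [0, 2, 0, 1, 0, 1]),
   ([2, 0, 1, 0, 1, 0], [0, 2, 0, 2, 0, 1]),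
   ([2, 0, 2, 0, 2, 0, 1], [1, 0, 1, 0, 1, 0]),
   ([2, 0, 2, 0, 2, 0, 2], [1, 0, 1, 0, 1, 0, 1]),
   ([1, 0, 1, 0, 1, 0, 1, 0], [0, 1, 0, 1, 0, 1, 0, 1])]

def nextLv (l : List Wd) : List Wd :=
  (l.flatMap fun w => [0 :: w, 1 :: w, 2 :: w, 3 :: w]).filter fun w => (stepO F w).isNone

def lvs : ℕ → List Wd → List Wd
  | 0, l => l
  | n + 1, l => l ++ lvs n (nextLv l)

def L : List Wd := lvs 10 [[]]

theorem F_sub : ∀ p ∈ F, p ∈ run R0 cert := by decide +kernel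

theorem L_closed : ∀ w ∈ L, ∀ s ∈ [0, 1, 2, 3], nrm F 20 (s :: w) ∈ L := by decide +kernel

theorem L_nil : [] ∈ L := by decide +kernel

theorem L_amb : ∀ w ∈ L, ∃ h ∈ ([[], [0], [3], [0, 3]] : List Wd),
    nrm F 20 (h ++ w) = nrm F 20 (winv w ++ h) := by decide +kernel

section
variable {G : Type*} [Group G] (a b c : G)

def e : ℕ → G
  | 0 => a
  | 1 => b
  | 2 => b⁻¹
  | _ => c

def ev (w : Wd) : G := (w.map (e a b c)).prod

theorem ev_append (u v : Wd) : ev a b c (u ++ v) = ev a b c u * ev a b c v := by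
  simp [ev]

theorem ev_cons (x : ℕ) (v : Wd) : ev a b c (x :: v) = e a b c x * ev a b c v := by
  simp [ev]

def Sound (R : List (Wd × Wd)) : Prop := ∀ p ∈ R, ev a b c p.1 = ev a b c p.2

variable {a b c}

theorem pre_sound (l w v : Wd) (h : pre l w = some v) : w = l ++ v := by
  induction l generalizing w with
  | nil => simpa [pre] using h
  | cons x l ih =>
    cases w with
    | nil => simp [pre] at h
    | cons y w =>
      rw [pre] at h
      cases hxy : Nat.beq x y with
      | false => simp [hxy] at h
      | true =>
        rw [hxy, cond_true] at h
        rw [ih w h, Nat.eq_of_beq_eq_true hxy, List.cons_append]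

theorem hd_sound {R : List (Wd × Wd)} (hR : Sound a b c R) (w v : Wd) (h : hd R w = some v) :
    ev a b c v = ev a b c w := by
  induction R with
  | nil => simp [hd] at h
  | cons p R ih =>
    rw [hd] at h
    split at h
    · next t ht =>
      have := hR p (by simp)
      simp only [Option.some.injEq] at h
      rw [← h, pre_sound _ _ _ ht, ev_append, ev_append, this]
    · exact ih (fun q hq => hR q (by simp [hq])) h

theorem stepO_sound {R : List (Wd × Wd)} (hR : Sound a b c R) (w v : Wd)
    (h : stepO R w = some v) : ev a b c v = ev a b c w := by
  induction w generalizing v with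
  | nil => simp [stepO] at h
  | cons x w ih =>
    rw [stepO] at h
    split at h
    · next t ht =>
      simp only [Option.some.injEq] at h
      rw [← h]
      exact hd_sound hR _ _ ht
    · split at h
      · next t ht =>
        simp only [Option.some.injEq] at h
        rw [← h, ev_cons, ev_cons, ih _ ht]
      · simp at h

theorem step_sound {R : List (Wd × Wd)} (hR : Sound a b c R) (w : Wd) :
    ev a b c (step R w) = ev a b c w := by
  rw [step]
  cases h : stepO R w with
  | none => rfl
  | some v => exact stepO_sound hR _ _ h

theorem nrm_sound {R : List (Wd × Wd)} (hR : Sound a b c R) (n : ℕ) (w : Wd) :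
    ev a b c (nrm R n w) = ev a b c w := by
  induction n generalizing w with
  | zero => rfl
  | succ n ih =>
    rw [nrm]
    split
    · next v h => rw [ih, stepO_sound hR _ _ h]
    · rfl

theorem get_sound {R : List (Wd × Wd)} (hR : Sound a b c R) (i : ℕ) :
    Sound a b c [R.getD i ([], [])] := by
  intro p hp
  simp only [List.mem_singleton] at hp
  subst hp
  by_cases h : i < R.length
  · rw [List.getD_eq_getElem _ _ h]
    exact hR _ (List.getElem_mem h)
  · rw [List.getD_eq_default _ _ (by omega)]

theorem run_sound (cs : List (ℕ × ℕ × Wd × Bool)) {R : List (Wd × Wd)} (hR : Sound a b c R) :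
    Sound a b c (run R cs) := by
  induction cs generalizing R with
  | nil => exact hR
  | cons x cs ih =>
    obtain ⟨i, j, o, s⟩ := x
    have hu := (nrm_sound hR 20 _).trans (step_sound (get_sound hR i) o)
    have hv := (nrm_sound hR 20 _).trans (step_sound (get_sound hR j) o)
    rw [run]
    generalize nrm R 20 (step [R.getD i ([], [])] o) = u at hu ⊢
    generalize nrm R 20 (step [R.getD j ([], [])] o) = v at hv ⊢
    apply ih
    intro p hp
    rw [List.mem_append] at hp
    rcases hp with hp | hp
    · exact hR p hp
    · rw [List.mem_singleton] at hp
      subst hp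
      cases s
      · exact hu.trans hv.symm
      · exact hv.trans hu.symm

theorem ev_winv (ha : a * a = 1) (hc : c * c = 1) (w : Wd) :
    ev a b c (winv w) = (ev a b c w)⁻¹ := by
  induction w with
  | nil => simp [winv, ev]
  | cons x w ih =>
    have h1 : winv (x :: w) = winv w ++ [sw x] := by simp [winv]
    have h2 : e a b c (sw x) = (e a b c x)⁻¹ := by
      match x with
      | 0 => exact eq_inv_of_mul_eq_one_left ha
      | 1 => rfl
      | 2 => simp [e, sw]
      | n + 3 => exact eq_inv_of_mul_eq_one_left hc
    rw [h1, ev_append, ih, ev_cons a b c x w, mul_inv_rev, ← h2]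
    simp [ev]

theorem R0_sound (h1 : a ^ 2 = 1) (h2 : b ^ 3 = 1)
    (h3 : (a * b * a * b⁻¹ * a * b⁻¹) ^ 2 = 1) (h4 : c ^ 2 = 1) (h5 : (c * a) ^ 2 = 1)
    (h6 : (c * b) ^ 2 = 1) : Sound a b c R0 := by
  have ha : a⁻¹ = a := inv_eq_of_mul_eq_one_left (by rw [← sq, h1])
  have hc : c⁻¹ = c := inv_eq_of_mul_eq_one_left (by rw [← sq, h4])
  have hb : b * b = b⁻¹ := eq_inv_of_mul_eq_one_left (by rw [← h2, pow_succ, sq])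
  have hca : c * a = a * c := by
    have : c * a = (c * a)⁻¹ := eq_inv_of_mul_eq_one_left (by rw [← sq, h5])
    rw [this, mul_inv_rev, ha, hc]
  have hcb : c * b = b⁻¹ * c := by
    have : c * b = (c * b)⁻¹ := eq_inv_of_mul_eq_one_left (by rw [← sq, h6])
    rw [this, mul_inv_rev, hc]
  have hcB : c * b⁻¹ = b * c := by
    rw [mul_inv_eq_iff_eq_mul, mul_assoc, hcb, mul_inv_cancel_left]
  have hBB : b⁻¹ * b⁻¹ = b := by rw [← mul_inv_rev, hb, inv_inv]
  intro p hp
  simp only [R0, List.mem_cons, List.not_mem_nil, or_false] at hp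
  rcases hp with rfl | rfl | rfl | rfl | rfl | rfl | rfl | rfl | rfl | rfl
  · simpa [ev, e, sq] using h1
  · simpa [ev, e] using hb
  · simp [ev, e]
  · simp [ev, e]
  · simpa [ev, e, sq] using h4
  · simpa only [ev, e, List.map, List.prod_cons, List.prod_nil, mul_one] using hBB
  · simpa [ev, e] using hca
  · simpa [ev, e] using hcb
  · simpa [ev, e] using hcB
  · simpa [ev, e, sq, mul_assoc] using h3

end

theorem trace_conj {V : Type*} [AddCommGroup V] [Module ℂ V] [FiniteDimensional ℂ V]
    (T S : Module.End ℂ V) (n : ℕ) (hn : n ≠ 0) (hT : T ^ n = 1) (hS : S * T = 1) :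
    LinearMap.trace ℂ V S = (starRingEnd ℂ) (LinearMap.trace ℂ V T) := by
  classical
  have hss : T.IsSemisimple := by
    apply Module.End.isSemisimple_of_squarefree_aeval_eq_zero
      (p := (Polynomial.X ^ n - 1 : Polynomial ℂ))
    · exact (Polynomial.separable_X_pow_sub_C (1 : ℂ) (by exact_mod_cast hn)
        one_ne_zero).squarefree
    · simp [hT]
  have hint := DirectSum.isInternal_submodule_of_iSupIndep_of_iSup_eq_top
    T.eigenspaces_iSupIndep hss.iSup_eigenspace_eq_top
  let B := hint.collectedBasis fun μ => Module.finBasis ℂ (T.eigenspace μ)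
  have := Module.Finite.finite_basis B
  have := Fintype.ofFinite (Σ μ : ℂ, Fin (Module.finrank ℂ (T.eigenspace μ)))
  have hB : ∀ i, T (B i) = i.1 • B i := fun i =>
    Module.End.mem_eigenspace_iff.1 (hint.collectedBasis_mem _ i)
  have hpow : ∀ i (k : ℕ), (T ^ k) (B i) = i.1 ^ k • B i := by
    intro i k
    induction k with
    | zero => simp
    | succ k ih => rw [pow_succ', Module.End.mul_apply, ih, map_smul, hB, smul_smul, pow_succ]
  have hone : ∀ i : (Σ μ : ℂ, Fin (Module.finrank ℂ (T.eigenspace μ))), i.1 ^ n = 1 := by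
    intro i
    have h := hpow i n
    rw [hT, Module.End.one_apply] at h
    have h' : (i.1 ^ n - 1) • B i = 0 := by rw [sub_smul, one_smul, ← h, sub_self]
    rcases smul_eq_zero.1 h' with h' | h'
    · exact sub_eq_zero.1 h'
    · exact absurd h' (B.ne_zero i)
  have hSB : ∀ i, S (B i) = (starRingEnd ℂ) i.1 • B i := by
    intro i
    have hnorm := Complex.norm_eq_one_of_pow_eq_one (hone i) hn
    have h0 : i.1 ≠ 0 := by
      intro h0
      rw [h0] at hnorm
      simp at hnorm
    have h : S (T (B i)) = B i := by rw [← Module.End.mul_apply, hS, Module.End.one_apply]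
    rw [hB, map_smul] at h
    rw [← RCLike.inv_eq_conj hnorm, eq_inv_smul_iff₀ h0, h]
  rw [LinearMap.trace_eq_matrix_trace ℂ B, LinearMap.trace_eq_matrix_trace ℂ B, Matrix.trace,
    Matrix.trace, map_sum]
  refine Finset.sum_congr rfl fun i _ => ?_
  simp [Matrix.diag, LinearMap.toMatrix_apply, hB, hSB]

end OctStar

open OctStar in
/-- every finite-dimensional irreducible complex representation of the
presented group P* (≅ G*, of order 96) has a real-valued character. -/
theorem stmt_10 (V : FDRep ℂ (PresentedGroup octRelsStar))
    (hV : CategoryTheory.Simple V) :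
    ∀ g : PresentedGroup octRelsStar, (V.character g).im = 0 := by
  intro g
  let a : PresentedGroup octRelsStar := PresentedGroup.of 0
  let b : PresentedGroup octRelsStar := PresentedGroup.of 1
  let c : PresentedGroup octRelsStar := PresentedGroup.of 2
  have hr : ∀ r ∈ octRelsStar, PresentedGroup.mk octRelsStar r = 1 :=
    fun r h => PresentedGroup.one_of_mem h
  have h1 : a ^ 2 = 1 := hr _ (by simp [octRelsStar])
  have h2 : b ^ 3 = 1 := hr _ (by simp [octRelsStar])
  have h3 : (a * b * a * b⁻¹ * a * b⁻¹) ^ 2 = 1 := hr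
    ((FreeGroup.of 0 * FreeGroup.of 1 * FreeGroup.of 0 * (FreeGroup.of 1)⁻¹ *
      FreeGroup.of 0 * (FreeGroup.of 1)⁻¹) ^ 2) (by simp [octRelsStar])
  have h4 : c ^ 2 = 1 := hr _ (by simp [octRelsStar])
  have h5 : (c * a) ^ 2 = 1 := hr ((FreeGroup.of 2 * FreeGroup.of 0) ^ 2) (by simp [octRelsStar])
  have h6 : (c * b) ^ 2 = 1 := hr ((FreeGroup.of 2 * FreeGroup.of 1) ^ 2) (by simp [octRelsStar])
  have ha : a * a = 1 := by rw [← sq, h1]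
  have hc : c * c = 1 := by rw [← sq, h4]
  have hF : Sound a b c F := fun p hp =>
    run_sound cert (R0_sound h1 h2 h3 h4 h5 h6) p (F_sub p hp)
  have hmul : ∀ s ∈ [0, 1, 2, 3], ∀ x, (∃ w ∈ L, ev a b c w = x) →
      ∃ w ∈ L, ev a b c w = e a b c s * x := by
    rintro s hs x ⟨w, hw, rfl⟩
    exact ⟨_, L_closed w hw s hs, by rw [nrm_sound hF, ev_cons]⟩
  have hall : ∀ x, ∃ w ∈ L, ev a b c w = x := by
    intro x
    have hx : x ∈ Subgroup.closure (Set.range (PresentedGroup.of (rels := octRelsStar))) := by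
      rw [PresentedGroup.closure_range_of]; trivial
    induction hx using Subgroup.closure_induction_left with
    | one => exact ⟨[], L_nil, rfl⟩
    | mul_left y hy z _ ih =>
      obtain ⟨i, rfl⟩ := hy
      fin_cases i
      · exact hmul 0 (by simp) _ ih
      · exact hmul 1 (by simp) _ ih
      · exact hmul 3 (by simp) _ ih
    | inv_mul_cancel y hy z _ ih =>
      obtain ⟨i, rfl⟩ := hy
      fin_cases i
      · have : a⁻¹ = a := inv_eq_of_mul_eq_one_left ha
        have h := hmul 0 (by simp) _ ih
        change ∃ w ∈ L, ev a b c w = a⁻¹ * z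
        rw [this]; exact h
      · exact hmul 2 (by simp) _ ih
      · have : c⁻¹ = c := inv_eq_of_mul_eq_one_left hc
        have h := hmul 3 (by simp) _ ih
        change ∃ w ∈ L, ev a b c w = c⁻¹ * z
        rw [this]; exact h
  have : Finite (PresentedGroup octRelsStar) := by
    refine Finite.of_surjective (fun w : {w // w ∈ L} => ev a b c w.1) fun x => ?_
    obtain ⟨w, hw, h⟩ := hall x
    exact ⟨⟨w, hw⟩, h⟩
  obtain ⟨w, hw, hg⟩ := hall g
  obtain ⟨h, -, hh⟩ := L_amb w hw
  have key : ev a b c h * g * (ev a b c h)⁻¹ = g⁻¹ := by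
    have := congrArg (ev a b c) hh
    rw [nrm_sound hF, nrm_sound hF, ev_append, ev_append, ev_winv ha hc, hg] at this
    rw [this, mul_inv_cancel_right]
  have hinv : V.character g⁻¹ = V.character g := by rw [← key, FDRep.char_conj]
  have hconj : V.character g⁻¹ = (starRingEnd ℂ) (V.character g) := by
    refine trace_conj (V.ρ g) (V.ρ g⁻¹) (orderOf g) (orderOf_pos g).ne' ?_ ?_
    · rw [← map_pow, pow_orderOf_eq_one, map_one]
    · rw [← map_mul, inv_mul_cancel, map_one]
  exact Complex.conj_eq_iff_im.1 (hconj.symm.trans hinv)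
end
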